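/- Let τ = ℕ → ℕ and let t : ℕ be a System T term whose only free variable is α : ℕ → (ℕ → ℕ). Using the translation t ↦ t° with the modified clause for α°, there exists a bar S which secures fun α => ⟦t⟧(α) and such that ⟦B_{t°}⟧ satisfies the general bar-recursion equation GenBR_S; consequently Φ^t(⟦B_{t°}⟧) satisfies Spector's bar-recursion equation for Y = fun α => ⟦t⟧(α). (Extension of Theorem 3.3 and Corollary 3.4 to τ = ℕ → ℕ, Section 3.4.) -/

import Mathlib

/-- Extension of a finite sequence `s` by infinitely many copies of `z` (the "hat"). -/
def ext {τ : Type*} (z : τ) (s : List τ) : ℕ → τ := fun n => s.getD n z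

/-- Concatenation `s * β` of a finite sequence with an infinite one. -/
def cat {τ : Type*} (s : List τ) (β : ℕ → τ) : ℕ → τ :=
  fun n => if h : n < s.length then s[n] else β (n - s.length)

/-- `S` is a bar: decidable, monotone, and hit by every infinite sequence. -/
def IsBar {τ : Type*} (S : List τ → Prop) : Prop :=
  (∀ s, S s ∨ ¬ S s) ∧ (∀ s t : List τ, S s → S (s ++ t)) ∧
    (∀ α : ℕ → τ, ∃ n : ℕ, S ((List.range n).map α))

/-- `S` secures `Y`: whenever `S s` holds, `fun β => Y (s * β)` is constant. -/
def Secures {τ : Type*} (S : List τ → Prop) (Y : (ℕ → τ) → ℕ) : Prop :=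
  ∀ s, S s → ∀ β β' : ℕ → τ, Y (cat s β) = Y (cat s β')

/-- The general bar-recursion equation for the bar `S`. -/
def GenBR {τ σ : Type*} (S : List τ → Prop)
    (Δ : (List τ → σ) → (List τ → (τ → σ) → σ) → List τ → σ) : Prop :=
  ∀ G H s, (S s → Δ G H s = G s) ∧
    (¬ S s → Δ G H s = H s (fun x => Δ G H (s ++ [x])))

/-- Spector's bar-recursion equation for the stopping functional `Y`. -/
def SpectorBR {τ σ : Type*} (z : τ) (Y : (ℕ → τ) → ℕ)
    (ξ : (List τ → σ) → (List τ → (τ → σ) → σ) → List τ → σ) : Prop :=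
  ∀ G H s, (Y (ext z s) < s.length → ξ G H s = G s) ∧
    (s.length ≤ Y (ext z s) → ξ G H s = H s (fun x => ξ G H (s ++ [x])))

/-- The auxiliary functional `φ`. -/
def phi {τ σ : Type*} (G : List τ → σ) (H : List τ → (τ → σ) → σ) : ℕ → List τ → σ
  | 0 => G
  | n + 1 => fun s => H s (fun x => phi G H n (s ++ [x]))

/-- The functional `Ψ`, bar recursion for a constant stopping functional. -/
def psi {τ σ : Type*} (k : ℕ) (G : List τ → σ) (H : List τ → (τ → σ) → σ)
    (s : List τ) : σ :=
  if s.length > k then G s else phi G H (k + 1 - s.length) s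

/-- Simple finite types, built only from `ℕ` and `→`. -/
inductive Ty where
  | nat : Ty
  | arr : Ty → Ty → Ty

/-- Set-theoretic semantics of simple types. -/
def Ty.sem : Ty → Type
  | .nat => ℕ
  | .arr a b => a.sem → b.sem

/-- Typed de Bruijn indices into a context. -/
inductive Idx {κ : Type} : List κ → κ → Type where
  | zero {Γ ρ} : Idx (ρ :: Γ) ρ
  | succ {Γ ρ η} : Idx Γ ρ → Idx (η :: Γ) ρ

/-- Semantic environments for a context. -/
def Env {κ : Type} (f : κ → Type*) : List κ → Type _
  | [] => PUnit
  | ρ :: Γ => f ρ × Env f Γ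

/-- Looking up a variable in an environment. -/
def Idx.lookup {κ : Type} {f : κ → Type*} : ∀ {Γ : List κ} {ρ : κ}, Idx Γ ρ → Env f Γ → f ρ
  | _, _, .zero, e => e.1
  | _, _, .succ v, e => v.lookup e.2

/-- Terms of Gödel's System T over the simple types, in a context `Γ`, with a
distinguished variable (constant) `alpha : ℕ → τv`, the constants `0`, `Succ`,
and the recursors `Rec^ℕ` and `Rec^{ρ → ℕ}` of the paper. -/
inductive Tm (τv : Ty) : List Ty → Ty → Type where
  | var {Γ ρ} : Idx Γ ρ → Tm τv Γ ρ
  | lam {Γ a b} : Tm τv (a :: Γ) b → Tm τv Γ (.arr a b)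
  | app {Γ a b} : Tm τv Γ (.arr a b) → Tm τv Γ a → Tm τv Γ b
  | zero {Γ} : Tm τv Γ .nat
  | succ {Γ} : Tm τv Γ (.arr .nat .nat)
  | alpha {Γ} : Tm τv Γ (.arr .nat τv)
  | recN {Γ} : Tm τv Γ (.arr .nat (.arr (.arr .nat (.arr .nat .nat)) (.arr .nat .nat)))
  | recA {Γ} (ρ : Ty) : Tm τv Γ (.arr (.arr ρ .nat)
      (.arr (.arr .nat (.arr (.arr ρ .nat) (.arr ρ .nat))) (.arr .nat (.arr ρ .nat))))

/-- Standard set-theoretic semantics of terms, parametrized by the value of `alpha`. -/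
def Tm.sem {τv : Ty} : ∀ {Γ ρ}, Tm τv Γ ρ → (ℕ → τv.sem) → Env Ty.sem Γ → ρ.sem
  | _, _, .var v, _, e => v.lookup e
  | _, _, .lam t, α, e => fun x => t.sem α (x, e)
  | _, _, .app u v, α, e => u.sem α e (v.sem α e)
  | _, _, .zero, _, _ => (0 : ℕ)
  | _, _, .succ, _, _ => Nat.succ
  | _, _, .alpha, α, _ => α
  | _, _, .recN, _, _ => fun a f n => Nat.rec (motive := fun _ => ℕ) a f n
  | _, _, .recA ρ, _, _ => fun a f n => Nat.rec (motive := fun _ => Ty.sem ρ → ℕ) a f n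

/-- The constant-zero function, `0_τ` for `τ = ℕ → ℕ`. -/
def zfn : ℕ → ℕ := fun _ => 0

/-- Semantics of the type translation `ρ ↦ ρ°` for `τ = ℕ → ℕ` and result type `σS`:
`ℕ°` is interpreted by `((ℕ → τ) → ℕ) × ((τ* → σ) → (τ* → (τ → σ) → σ) → τ* → σ)`
and `(ρ₀ → ρ₁)°` by functions. -/
def TyC2 (σS : Type*) : Ty → Type _
  | .nat => ((ℕ → (ℕ → ℕ)) → ℕ) ×
      ((List (ℕ → ℕ) → σS) → (List (ℕ → ℕ) → ((ℕ → ℕ) → σS) → σS) → List (ℕ → ℕ) → σS)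
  | .arr a b => TyC2 σS a → TyC2 σS b

/-- The interpretation of the numeral translation `k° = ⟨λα.k, λG H.G⟩`. -/
def kc2 (σS : Type*) (k : ℕ) : TyC2 σS .nat := ⟨fun _ => k, fun G _ => G⟩

/-- Semantics of the term translation `t ↦ t°` for `τ = ℕ → ℕ`, with the modified
clause for `α°` of Section 3.4. -/
def Tm.csem2 (σS : Type*) : ∀ {Γ ρ}, Tm (.arr .nat .nat) Γ ρ → Env (TyC2 σS) Γ → TyC2 σS ρ
  | _, _, .var v, e => v.lookup e
  | _, _, .lam t, e => fun x => t.csem2 σS (x, e)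
  | _, _, .app u v, e => u.csem2 σS e (v.csem2 σS e)
  | _, _, .zero, _ => ⟨fun _ => (0 : ℕ), fun G _ => G⟩
  | _, _, .succ, _ => fun x => ⟨fun α => Nat.succ (x.1 α), x.2⟩
  | _, _, .alpha, _ => fun x y =>
      ⟨fun α => α (x.1 α) (y.1 α),
       fun G H s =>
        y.2 (x.2 (fun s' => psi (max (x.1 (ext zfn s')) (y.1 (ext zfn s'))) G H s') H) H s⟩
  | _, _, .recN, _ => fun a F x =>
      let r : ℕ → TyC2 σS .nat :=
        fun n => Nat.rec (motive := fun _ => TyC2 σS .nat) a (fun k ih => F (kc2 σS k) ih) n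
      ⟨fun α => (r (x.1 α)).1 α,
       fun G H s => x.2 (fun s' => (r (x.1 (ext zfn s'))).2 G H s') H s⟩
  | _, _, .recA ρ, _ => fun a F x v =>
      let r : ℕ → TyC2 σS (.arr ρ .nat) :=
        fun n => Nat.rec (motive := fun _ => TyC2 σS (.arr ρ .nat)) a (fun k ih => F (kc2 σS k) ih) n
      ⟨fun α => (r (x.1 α) v).1 α,
       fun G H s => x.2 (fun s' => (r (x.1 (ext zfn s')) v).2 G H s') H s⟩

/-- The functional `H^t` (with `Y = ⟦t⟧`). -/
def Hdag {τ σ : Type*} (z : τ) (t : (ℕ → τ) → ℕ) (G : List τ → σ)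
    (H : List τ → (τ → σ) → σ) (s : List τ) (f : τ → σ) : σ :=
  if t (ext z s) < s.length then G s else H s f

/-- The functional `Φ^t`. -/
def PhiT {τ σ : Type*} (z : τ) (t : (ℕ → τ) → ℕ)
    (Δ : (List τ → σ) → (List τ → (τ → σ) → σ) → List τ → σ)
    (G : List τ → σ) (H : List τ → (τ → σ) → σ) (s : List τ) : σ :=
  Δ (fun s' => psi (t (ext z s')) G H s') (Hdag z t G H) s

theorem cat_append {τ : Type*} (s t : List τ) (β : ℕ → τ) :
    cat (s ++ t) β = cat s (cat t β) := by
  funext n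
  simp only [cat, List.length_append, List.getElem_append]
  split_ifs <;> first | rfl | omega | (congr 1; omega)

theorem ext_eq_cat {τ : Type*} (z : τ) (s : List τ) : ext z s = cat s (fun _ => z) := by
  funext n
  simp only [ext, cat, List.getD_eq_getElem?_getD]
  split_ifs with h <;> simp [h]

theorem cat_of_lt {τ : Type*} {s : List τ} {β : ℕ → τ} {n : ℕ} (h : n < s.length) :
    cat s β n = s[n] := by
  simp [cat, h]

theorem Secures.ext_append {τ : Type*} {S : List τ → Prop} {Y : (ℕ → τ) → ℕ}
    (h : Secures S Y) (z : τ) {s : List τ} (hs : S s) (t : List τ) :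
    Y (ext z (s ++ t)) = Y (ext z s) := by
  rw [ext_eq_cat, ext_eq_cat, cat_append]
  exact h s hs _ _

theorem Secures.eq_ext {τ : Type*} {S : List τ → Prop} {Y : (ℕ → τ) → ℕ}
    (h : Secures S Y) (z : τ) {s : List τ} (hs : S s) (β : ℕ → τ) :
    Y (cat s β) = Y (ext z s) := by
  rw [ext_eq_cat]
  exact h s hs _ _

theorem Secures.mono {τ : Type*} {S T : List τ → Prop} {Y : (ℕ → τ) → ℕ}
    (h : Secures S Y) (hTS : ∀ s, T s → S s) : Secures T Y :=
  fun s hs => h s (hTS s hs)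

theorem IsBar.of_le {τ : Type*} {S : List τ → Prop} (hS : IsBar S) {α : ℕ → τ} {m n : ℕ}
    (hmn : m ≤ n) (h : S ((List.range m).map α)) : S ((List.range n).map α) := by
  obtain ⟨k, rfl⟩ := Nat.exists_eq_add_of_le hmn
  rw [List.range_add, List.map_append]
  exact hS.2.1 _ _ h

theorem isBar_true {τ : Type*} : IsBar (fun _ : List τ => True) :=
  ⟨fun _ => Or.inl trivial, fun _ _ _ => trivial, fun _ => ⟨0, trivial⟩⟩

theorem isBar_length_gt {τ : Type*} (k : ℕ) : IsBar (fun s : List τ => k < s.length) :=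
  ⟨fun _ => em _, fun s t h => by
    simp only [List.length_append] at h ⊢
    omega, fun _ => ⟨k + 1, by simp⟩⟩

/-- A bar `S` securing `Y`, followed by a bar `T` chosen according to the value of `Y`, is a
bar. -/
theorem IsBar.comp {τ : Type*} {S : List τ → Prop} {T : ℕ → List τ → Prop}
    {Y : (ℕ → τ) → ℕ} (z : τ) (hS : IsBar S) (hT : ∀ k, IsBar (T k)) (hY : Secures S Y) :
    IsBar (fun s => S s ∧ T (Y (ext z s)) s) := by
  refine ⟨fun _ => em _, fun s t h => ⟨hS.2.1 _ _ h.1, ?_⟩, fun α => ?_⟩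
  · rw [hY.ext_append z h.1]
    exact (hT _).2.1 _ _ h.2
  · obtain ⟨m, hm⟩ := hS.2.2 α
    obtain ⟨n, hn⟩ := (hT (Y (ext z ((List.range m).map α)))).2.2 α
    refine ⟨max m n, hS.of_le (le_max_left m n) hm, ?_⟩
    obtain ⟨k, hk⟩ := Nat.exists_eq_add_of_le (le_max_left m n)
    have hv : Y (ext z ((List.range (max m n)).map α)) = Y (ext z ((List.range m).map α)) := by
      rw [hk, List.range_add, List.map_append]
      exact hY.ext_append z hm _
    rw [hv]
    exact (hT _).of_le (le_max_right m n) hn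

/-- General bar recursion for the composite bar of `IsBar.comp`. -/
theorem GenBR.comp {τ σ : Type*} {S : List τ → Prop} {T : ℕ → List τ → Prop}
    {Y : (ℕ → τ) → ℕ} {Δ : (List τ → σ) → (List τ → (τ → σ) → σ) → List τ → σ}
    {E : ℕ → (List τ → σ) → (List τ → (τ → σ) → σ) → List τ → σ} (z : τ)
    (hS : IsBar S) (hY : Secures S Y) (hΔ : GenBR S Δ) (hE : ∀ k, GenBR (T k) (E k)) :
    GenBR (fun s => S s ∧ T (Y (ext z s)) s)
      (fun G H s => Δ (fun s' => E (Y (ext z s')) G H s') H s) := by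
  intro G H s
  refine ⟨fun h => ?_, fun h => ?_⟩
  · exact ((hΔ _ H s).1 h.1).trans ((hE _ G H s).1 h.2)
  · by_cases hs : S s
    · have ht : ¬ T (Y (ext z s)) s := fun ht => h ⟨hs, ht⟩
      refine ((hΔ _ H s).1 hs).trans (((hE _ G H s).2 ht).trans ?_)
      congr 1
      funext x
      refine Eq.trans ?_ ((hΔ _ H (s ++ [x])).1 (hS.2.1 _ _ hs)).symm
      rw [hY.ext_append z hs]
    · exact (hΔ _ H s).2 hs

theorem psi_of_lt {τ σ : Type*} {k : ℕ} {s : List τ} (h : k < s.length) (G : List τ → σ)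
    (H : List τ → (τ → σ) → σ) : psi k G H s = G s :=
  if_pos h

theorem psi_of_le {τ σ : Type*} {k : ℕ} {s : List τ} (h : s.length ≤ k) (G : List τ → σ)
    (H : List τ → (τ → σ) → σ) : psi k G H s = H s (fun x => psi k G H (s ++ [x])) := by
  obtain ⟨n, rfl⟩ := Nat.exists_eq_add_of_le h
  have h1 : s.length + n + 1 - s.length = n + 1 := by omega
  rw [psi, if_neg (by omega), h1]
  refine congrArg (H s) ?_
  funext x
  rw [psi, List.length_append, List.length_singleton]
  split_ifs with h2
  · obtain rfl : n = 0 := by omega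
    rfl
  · congr 1
    omega

theorem genBR_psi {τ σ : Type*} (k : ℕ) :
    GenBR (fun s : List τ => k < s.length) (psi (σ := σ) k) :=
  fun G H _ => ⟨fun h => psi_of_lt h G H, fun h => psi_of_le (not_lt.mp h) G H⟩

theorem SpectorBR.of_genBR {τ σ : Type*} (z : τ) {S : List τ → Prop} {Y : (ℕ → τ) → ℕ}
    {Δ : (List τ → σ) → (List τ → (τ → σ) → σ) → List τ → σ} (hS : IsBar S)
    (hY : Secures S Y) (hΔ : GenBR S Δ) : SpectorBR z Y (PhiT z Y Δ) := by
  intro G H s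
  simp only [PhiT]
  by_cases hs : S s
  · rw [(hΔ _ _ s).1 hs]
    refine ⟨fun h => psi_of_lt h G H, fun h => ?_⟩
    rw [psi_of_le h]
    congr 1
    funext x
    rw [(hΔ _ _ (s ++ [x])).1 (hS.2.1 _ _ hs), hY.ext_append z hs]
  · rw [(hΔ _ _ s).2 hs, Hdag]
    exact ⟨fun h => if_pos h, fun h => if_neg (not_lt.mpr h)⟩

/-- The logical relation between functions of `α` and elements of the translated type: at
base type the first component is the function itself, and the second is general bar recursion
for a bar securing it. -/
def BarRel (σS : Type*) : ∀ ρ : Ty, ((ℕ → ℕ → ℕ) → ρ.sem) → TyC2 σS ρ → Prop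
  | .nat, g, x => x.1 = g ∧ ∃ S, IsBar S ∧ Secures S x.1 ∧ GenBR S x.2
  | .arr a b, g, f => ∀ h x, BarRel σS a h x → BarRel σS b (fun α => g α (h α)) (f x)

/-- The logical relation `BarRel`, componentwise on environments. -/
def EnvRel (σS : Type*) : ∀ Γ : List Ty, ((ℕ → ℕ → ℕ) → Env Ty.sem Γ) → Env (TyC2 σS) Γ → Prop
  | [], _, _ => True
  | ρ :: Γ, e, e' => BarRel σS ρ (fun α => (e α).1) e'.1 ∧ EnvRel σS Γ (fun α => (e α).2) e'.2

theorem EnvRel.lookup {σS : Type*} {Γ : List Ty} {ρ : Ty} (v : Idx Γ ρ)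
    {e : (ℕ → ℕ → ℕ) → Env Ty.sem Γ} {e' : Env (TyC2 σS) Γ} (h : EnvRel σS Γ e e') :
    BarRel σS ρ (fun α => v.lookup (e α)) (v.lookup e') := by
  induction v with
  | zero => exact h.1
  | succ v ih => exact ih h.2

theorem barRel_kc2 (σS : Type*) (k : ℕ) : BarRel σS .nat (fun _ => k) (kc2 σS k) :=
  ⟨rfl, _, isBar_true, fun _ _ _ _ => rfl, fun _ _ _ => ⟨fun _ => rfl, fun h => (h trivial).elim⟩⟩

theorem barRel_succ {σS : Type*} {g : (ℕ → ℕ → ℕ) → ℕ} {x : TyC2 σS .nat}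
    (h : BarRel σS .nat g x) :
    BarRel σS .nat (fun α => Nat.succ (g α)) ⟨fun α => Nat.succ (x.1 α), x.2⟩ := by
  obtain ⟨rfl, S, hS, hY, hΔ⟩ := h
  exact ⟨rfl, S, hS, fun s hs β β' => congrArg Nat.succ (hY s hs β β'), hΔ⟩

/-- Substituting a numerical functional for the index of a family of related pairs. -/
theorem barRel_comp {σS : Type*} {g : (ℕ → ℕ → ℕ) → ℕ} {x : TyC2 σS .nat}
    (hx : BarRel σS .nat g x) {f : ℕ → (ℕ → ℕ → ℕ) → ℕ} {y : ℕ → TyC2 σS .nat}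
    (hy : ∀ k, BarRel σS .nat (f k) (y k)) :
    BarRel σS .nat (fun α => f (g α) α)
      ⟨fun α => (y (x.1 α)).1 α,
        fun G H s => x.2 (fun s' => (y (x.1 (ext zfn s'))).2 G H s') H s⟩ := by
  obtain ⟨rfl, S, hS, hY, hΔ⟩ := hx
  choose hf T hT hZ hE using hy
  refine ⟨funext fun α => congrFun (hf _) α, _, hS.comp zfn hT hY, ?_,
    GenBR.comp zfn hS hY hΔ hE⟩
  intro s hs β β'
  change (y (x.1 (cat s β))).1 (cat s β) = (y (x.1 (cat s β'))).1 (cat s β')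
  rw [hY.eq_ext zfn hs.1 β, hY.eq_ext zfn hs.1 β']
  exact hZ _ s hs.2 β β'

theorem barRel_alpha {σS : Type*} {g h : (ℕ → ℕ → ℕ) → ℕ} {x y : TyC2 σS .nat}
    (hx : BarRel σS .nat g x) (hy : BarRel σS .nat h y) :
    BarRel σS .nat (fun α => α (g α) (h α))
      ⟨fun α => α (x.1 α) (y.1 α), fun G H s =>
        y.2 (x.2 (fun s' => psi (max (x.1 (ext zfn s')) (y.1 (ext zfn s'))) G H s') H) H s⟩ := by
  obtain ⟨rfl, S, hS, hX, hΔ⟩ := hx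
  obtain ⟨rfl, T, hT, hY, hE⟩ := hy
  have hTS := hT.comp zfn (fun _ => hS) hY
  have hX' : Secures (fun s => T s ∧ S s) x.1 := hX.mono fun _ h => h.2
  have hY' : Secures (fun s => T s ∧ S s) y.1 := hY.mono fun _ h => h.1
  have hM : Secures (fun s => T s ∧ S s) (fun α => max (x.1 α) (y.1 α)) :=
    fun s hs β β' => congrArg₂ max (hX' s hs β β') (hY' s hs β β')
  refine ⟨rfl, _, hTS.comp zfn isBar_length_gt hM, ?_,
    GenBR.comp zfn hTS hM (GenBR.comp zfn hT hY hE fun _ => hΔ) genBR_psi⟩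
  intro s hs β β'
  have hlt : x.1 (ext zfn s) < s.length := lt_of_le_of_lt (le_max_left _ _) hs.2
  change cat s β (x.1 (cat s β)) (y.1 (cat s β)) = cat s β' (x.1 (cat s β')) (y.1 (cat s β'))
  rw [hX'.eq_ext zfn hs.1 β, hX'.eq_ext zfn hs.1 β', hY'.eq_ext zfn hs.1 β,
    hY'.eq_ext zfn hs.1 β', cat_of_lt hlt, cat_of_lt hlt]

theorem barRel_rec {σS : Type*} {ρ : Ty} {a : (ℕ → ℕ → ℕ) → ρ.sem} {a' : TyC2 σS ρ}
    {F : (ℕ → ℕ → ℕ) → ℕ → ρ.sem → ρ.sem} {F' : TyC2 σS .nat → TyC2 σS ρ → TyC2 σS ρ}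
    (ha : BarRel σS ρ a a') (hF : BarRel σS (.arr .nat (.arr ρ ρ)) F F') (n : ℕ) :
    BarRel σS ρ (fun α => Nat.rec (motive := fun _ => ρ.sem) (a α) (F α) n)
      (Nat.rec (motive := fun _ => TyC2 σS ρ) a' (fun k ih => F' (kc2 σS k) ih) n) := by
  induction n with
  | zero => exact ha
  | succ n ih => exact hF _ _ (barRel_kc2 σS n) _ _ ih

/-- The fundamental lemma of the logical relation. -/
theorem barRel_sem (σS : Type*) {Γ : List Ty} {ρ : Ty} (t : Tm (.arr .nat .nat) Γ ρ)
    (e : (ℕ → ℕ → ℕ) → Env Ty.sem Γ) (e' : Env (TyC2 σS) Γ) (he : EnvRel σS Γ e e') :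
    BarRel σS ρ (fun α => t.sem α (e α)) (t.csem2 σS e') := by
  induction t with
  | var v => exact he.lookup v
  | lam t ih => exact fun h x hx => ih (fun α => (h α, e α)) (x, e') ⟨hx, he⟩
  | app u v ihu ihv => exact ihu e e' he _ _ (ihv e e' he)
  | zero => exact barRel_kc2 σS 0
  | succ => exact fun _ _ hx => barRel_succ hx
  | alpha => exact fun _ _ hx _ _ hy => barRel_alpha hx hy
  | recN => exact fun _ _ ha _ _ hF _ _ hx => barRel_comp hx fun k => barRel_rec ha hF k
  | recA ρ =>
    exact fun _ _ ha _ _ hF _ _ hx _ _ hv =>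
      barRel_comp hx fun k => barRel_rec ha hF k _ _ hv

/-- Extension of Theorem 3.3 and Corollary 3.4 to `τ = ℕ → ℕ` (Section 3.4): for a
System T term `t : ℕ` whose only free variable is `α : ℕ → (ℕ → ℕ)`, there is a bar
`S` securing `fun α => ⟦t⟧(α)` such that `⟦B_{t°}⟧` satisfies `GenBR_S`;
consequently `Φ^t(⟦B_{t°}⟧)` satisfies Spector's bar-recursion equation for
`Y = fun α => ⟦t⟧(α)`. -/
theorem exists_bar_securing_fn (σS : Type*) (t : Tm (.arr .nat .nat) [] .nat) :
    (∃ S : List (ℕ → ℕ) → Prop, IsBar S ∧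
        Secures S (fun α => t.sem α PUnit.unit) ∧
        GenBR S (t.csem2 σS PUnit.unit).2) ∧
    SpectorBR zfn (fun α => t.sem α PUnit.unit)
      (PhiT zfn (fun α => t.sem α PUnit.unit) (t.csem2 σS PUnit.unit).2) := by
  obtain ⟨hval, S, hS, hY, hΔ⟩ := barRel_sem σS t (fun _ => PUnit.unit) PUnit.unit trivial
  obtain ⟨hval₁, S₁, hS₁, hY₁, hΔ₁⟩ := barRel_sem σS t (fun _ => PUnit.unit) PUnit.unit trivial
  obtain ⟨hval₂, -⟩ := barRel_sem σS t (fun _ => PUnit.unit) PUnit.unit trivial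
  refine ⟨⟨S, hS, hval ▸ hY, hΔ⟩, ?_⟩
  rw [← hval₁, ← hval₂]
  exact SpectorBR.of_genBR zfn hS₁ hY₁ hΔ₁
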